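/- arXiv:2412.06853 — 12 statements merged into one kernel-verified Lean document; each statement's English description precedes it below -/
import Mathlib

section
/- Fix t ∈ (0,1) and take r = 1/2. For every (u2, u1) ∈ ℝ² with u2 ≤ u1, the tube loss is symmetric about the line u1 + u2 = 0 in the sense that ρ_t^{1/2}(u2, u1) = ρ_t^{1/2}(−u1, −u2). -/
/-- The tube loss `ρ_t^r(u2, u1)` on `D = {(u2,u1) : u2 ≤ u1}`:
`t·u2` if `u2 > 0`; `−(1−t)·u2` if `u2 ≤ 0 ≤ u1` and `r·u2 + (1−r)·u1 ≥ 0`;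
`(1−t)·u1` if `u2 ≤ 0 ≤ u1` and `r·u2 + (1−r)·u1 < 0`; `−t·u1` if `u1 < 0`. -/
noncomputable def tubeLossU (t r u2 u1 : ℝ) : ℝ :=
  if 0 < u2 then t * u2
  else if u1 < 0 then -t * u1
  else if 0 ≤ r * u2 + (1 - r) * u1 then -(1 - t) * u2
  else (1 - t) * u1

/-- For `r = 1/2`, the tube loss is symmetric about the line `u1 + u2 = 0`:
`ρ_t^{1/2}(u2, u1) = ρ_t^{1/2}(−u1, −u2)` on `D`. -/
theorem tubeLossU_symm (t : ℝ) (ht : t ∈ Set.Ioo (0 : ℝ) 1)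
    (u2 u1 : ℝ) (h : u2 ≤ u1) :
    tubeLossU t (1 / 2) u2 u1 = tubeLossU t (1 / 2) (-u1) (-u2) := by
  unfold tubeLossU
  split_ifs
  all_goals first
    | ring1
    | (exfalso; linarith)
    | (obtain rfl : u1 = -u2 := by linarith
       ring)
end

section
/- Fix t ∈ (0,1) and r ∈ (0,1) with r ≠ 1/2. Then for every point (u2, u1) with u2 < 0 < u1 and r·u2 + (1−r)·u1 = 0, the tube loss (u2, u1) ↦ ρ_t^r(u2, u1), regarded as a function on D = {(u2, u1) : u2 ≤ u1}, is not continuous at (u2, u1): approaching the separating plane r·u2 + (1−r)·u1 = 0 from the two sides yields the distinct limits −(1−t)·u2 and (1−t)·u1. -/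
open Filter Topology

/-- The point `(u2, u1)` of the separating line is a limit of points of the open lower side. -/
lemma neBot_nhdsWithin_lower_side {r u2 u1 : ℝ} (hr : 0 < r) (hle : u2 ≤ u1)
    (hplane : r * u2 + (1 - r) * u1 = 0) :
    (𝓝[{p : ℝ × ℝ | p.1 ≤ p.2 ∧ r * p.1 + (1 - r) * p.2 < 0}] (u2, u1)).NeBot := by
  have hpath : Tendsto (fun ε : ℝ => (u2 - ε, u1)) (𝓝[>] 0)
      (𝓝[{p : ℝ × ℝ | p.1 ≤ p.2 ∧ r * p.1 + (1 - r) * p.2 < 0}] (u2, u1)) := by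
    refine tendsto_nhdsWithin_iff.2 ⟨?_, ?_⟩
    · have hc : Continuous fun ε : ℝ => (u2 - ε, u1) := by fun_prop
      simpa using (hc.tendsto 0).mono_left nhdsWithin_le_nhds
    · filter_upwards [self_mem_nhdsWithin] with ε hε
      have hε' : 0 < ε := hε
      exact ⟨by linarith, by nlinarith [mul_pos hr hε']⟩
  exact hpath.neBot

/-- For `r ≠ 1/2`, at any point `(u2, u1)` with `u2 < 0 < u1` lying on the
separating plane `r·u2 + (1−r)·u1 = 0`, the tube loss (regarded as a function on
`D = {(u2,u1) : u2 ≤ u1}`) is not continuous: approaching the plane from the side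
`r·u2 + (1−r)·u1 ≥ 0` yields the limit `−(1−t)·u2`, approaching from the side
`r·u2 + (1−r)·u1 < 0` yields the limit `(1−t)·u1`, and these two limits differ. -/
theorem tubeLossU_discontinuous_on_plane
    (t r : ℝ) (ht : t ∈ Set.Ioo (0 : ℝ) 1) (hr : r ∈ Set.Ioo (0 : ℝ) 1)
    (hr' : r ≠ 1 / 2) (u2 u1 : ℝ) (h2 : u2 < 0) (h1 : 0 < u1)
    (hplane : r * u2 + (1 - r) * u1 = 0) :
    Tendsto (fun p : ℝ × ℝ => tubeLossU t r p.1 p.2)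
        (𝓝[{p : ℝ × ℝ | p.1 ≤ p.2 ∧ 0 ≤ r * p.1 + (1 - r) * p.2}] (u2, u1))
        (𝓝 (-(1 - t) * u2)) ∧
      Tendsto (fun p : ℝ × ℝ => tubeLossU t r p.1 p.2)
        (𝓝[{p : ℝ × ℝ | p.1 ≤ p.2 ∧ r * p.1 + (1 - r) * p.2 < 0}] (u2, u1))
        (𝓝 ((1 - t) * u1)) ∧
      -(1 - t) * u2 ≠ (1 - t) * u1 ∧
      ¬ ContinuousWithinAt (fun p : ℝ × ℝ => tubeLossU t r p.1 p.2)
          {p : ℝ × ℝ | p.1 ≤ p.2} (u2, u1) := by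
  have hsign : ∀ᶠ p : ℝ × ℝ in 𝓝 (u2, u1), p.1 < 0 ∧ 0 < p.2 :=
    ((continuous_fst.tendsto (u2, u1)).eventually_lt_const h2).and
      ((continuous_snd.tendsto (u2, u1)).eventually_const_lt h1)
  have hupper : Tendsto (fun p : ℝ × ℝ => tubeLossU t r p.1 p.2)
      (𝓝[{p : ℝ × ℝ | p.1 ≤ p.2 ∧ 0 ≤ r * p.1 + (1 - r) * p.2}] (u2, u1))
      (𝓝 (-(1 - t) * u2)) := by
    have hc : Continuous fun p : ℝ × ℝ => -(1 - t) * p.1 := by fun_prop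
    refine ((hc.tendsto (u2, u1)).mono_left nhdsWithin_le_nhds).congr' ?_
    filter_upwards [self_mem_nhdsWithin, hsign.filter_mono nhdsWithin_le_nhds] with p hp hs
    simp only [tubeLossU, if_neg hs.1.not_gt, if_neg hs.2.not_gt, if_pos hp.2]
  have hlower : Tendsto (fun p : ℝ × ℝ => tubeLossU t r p.1 p.2)
      (𝓝[{p : ℝ × ℝ | p.1 ≤ p.2 ∧ r * p.1 + (1 - r) * p.2 < 0}] (u2, u1))
      (𝓝 ((1 - t) * u1)) := by
    have hc : Continuous fun p : ℝ × ℝ => (1 - t) * p.2 := by fun_prop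
    refine ((hc.tendsto (u2, u1)).mono_left nhdsWithin_le_nhds).congr' ?_
    filter_upwards [self_mem_nhdsWithin, hsign.filter_mono nhdsWithin_le_nhds] with p hp hs
    simp only [tubeLossU, if_neg hs.1.not_gt, if_neg hs.2.not_gt, if_neg hp.2.not_ge]
  have hne : -(1 - t) * u2 ≠ (1 - t) * u1 := by
    intro h
    have hu : -u2 = u1 := mul_left_cancel₀ (sub_pos.2 ht.2).ne' (by linarith)
    have hz : (1 - 2 * r) * u1 = 0 := by
      rw [← hu] at hplane ⊢
      linarith
    rcases mul_eq_zero.1 hz with h0 | h0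
    · exact hr' (by linarith)
    · exact h1.ne' h0
  refine ⟨hupper, hlower, hne, fun hcont => hne ?_⟩
  have hval : tubeLossU t r u2 u1 = -(1 - t) * u2 := by
    simp only [tubeLossU, if_neg h2.not_gt, if_neg h1.not_gt, if_pos hplane.ge]
  have := neBot_nhdsWithin_lower_side hr.1 (h2.trans h1).le hplane
  rw [← hval]
  exact tendsto_nhds_unique (hcont.mono fun _ hp => hp.1) hlower
end

section
/- Lowering the upper bound: let δ satisfy 0 < δ ≤ (1−r)·(μ2 − μ1), and suppose that no sample point y_i lies in the interval [μ2 − δ, μ2) and no sample point y_i lies in the interval [c − r·δ, c). Then the empirical risk satisfies the exact identity L(μ1, μ2 − δ) − L(μ1, μ2) = δ·[ t·(m1 + k1) − (1−t)·(m2 + k2) ]. -/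
/-- The tube loss `ρ_t^r(y, μ1, μ2)` (for `μ1 ≤ μ2`):
`t·(y − μ2)` if `y > μ2`; `(1−t)·(μ2 − y)` if `μ1 ≤ y ≤ μ2` and `y ≥ r·μ2 + (1−r)·μ1`;
`(1−t)·(y − μ1)` if `μ1 ≤ y ≤ μ2` and `y < r·μ2 + (1−r)·μ1`; `t·(μ1 − y)` if `y < μ1`. -/
noncomputable def tubeLoss (t r y μ1 μ2 : ℝ) : ℝ :=
  if μ2 < y then t * (y - μ2)
  else if y < μ1 then t * (μ1 - y)
  else if r * μ2 + (1 - r) * μ1 ≤ y then (1 - t) * (μ2 - y)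
  else (1 - t) * (y - μ1)

/-- The change in the tube loss of a single observation when the upper bound is lowered by `δ`. -/
theorem tubeLoss_lower_upper_bound_sub {t r y μ1 μ2 c δ : ℝ}
    (hr : r ∈ Set.Ioo (0 : ℝ) 1) (hμ : μ1 < μ2) (hc : c = r * μ2 + (1 - r) * μ1)
    (hδ0 : 0 < δ) (hδ : δ ≤ (1 - r) * (μ2 - μ1))
    (hgap1 : ¬ (μ2 - δ ≤ y ∧ y < μ2)) (hgap2 : ¬ (c - r * δ ≤ y ∧ y < c)) :
    tubeLoss t r y μ1 (μ2 - δ) - tubeLoss t r y μ1 μ2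
      = δ * (t * ((if μ2 < y then 1 else 0) + (if y = μ2 then 1 else 0))
        - (1 - t) * ((if c < y ∧ y < μ2 then 1 else 0) + (if y = c then 1 else 0))) := by
  obtain ⟨hr0, hr1⟩ := hr
  have hcμ1 : μ1 < c := by nlinarith [mul_pos hr0 (sub_pos.2 hμ)]
  have hcμ2 : c ≤ μ2 - δ := by linarith
  have hrδ : 0 < r * δ := mul_pos hr0 hδ0
  have hc' : r * (μ2 - δ) + (1 - r) * μ1 = c - r * δ := by rw [hc]; ring
  simp only [tubeLoss, hc', ← hc]
  clear hc hc' hδ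
  rcases lt_or_ge y c with hyc | hyc
  · have hy : y < c - r * δ := by
      by_contra! h
      exact hgap2 ⟨h, hyc⟩
    simp [show ¬ μ2 < y by linarith, show ¬ μ2 - δ < y by linarith, show y ≠ μ2 by linarith,
      show ¬ c < y by linarith, hyc.ne, hyc.not_ge, hy.not_ge]
  · rcases lt_or_ge y μ2 with hy2 | hy2
    · have hy : y < μ2 - δ := by
        by_contra! h
        exact hgap1 ⟨h, hy2⟩
      rcases hyc.eq_or_lt with rfl | hyc'
      · simp [hy2.not_gt, hy.not_gt, hcμ1.not_gt, hy2.ne, hrδ.le]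
        ring
      · simp [hy2.not_gt, hy.not_gt, show ¬ y < μ1 by linarith, hy2.ne, hy2, hyc', hyc'.ne', hyc,
          show c - r * δ ≤ y by linarith]
        ring
    · rcases hy2.eq_or_lt with rfl | hy2'
      · simp [hδ0, hμ.not_gt, hyc, show μ2 ≠ c by linarith]
        ring
      · simp [hy2', show μ2 - δ < y by linarith, hy2'.ne', hy2'.not_gt, show y ≠ c by linarith]
        ring

/-- Lowering the upper bound: if `0 < δ ≤ (1−r)·(μ2 − μ1)`, no sample lies in
`[μ2 − δ, μ2)` and none in `[c − r·δ, c)` with `c = r·μ2 + (1−r)·μ1`, then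
`L(μ1, μ2 − δ) − L(μ1, μ2) = δ·(t·(m1 + k1) − (1−t)·(m2 + k2))`. -/
theorem tubeLoss_risk_lower_upper_bound
    (t r : ℝ) (ht : t ∈ Set.Ioo (0 : ℝ) 1) (hr : r ∈ Set.Ioo (0 : ℝ) 1)
    (m : ℕ) (y : Fin m → ℝ) (μ1 μ2 c : ℝ) (hμ : μ1 < μ2)
    (hc : c = r * μ2 + (1 - r) * μ1)
    (m1 k1 m2 k2 : ℝ)
    (hm1 : m1 = ((Finset.univ.filter (fun i => μ2 < y i)).card : ℝ))
    (hk1 : k1 = ((Finset.univ.filter (fun i => y i = μ2)).card : ℝ))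
    (hm2 : m2 = ((Finset.univ.filter (fun i => c < y i ∧ y i < μ2)).card : ℝ))
    (hk2 : k2 = ((Finset.univ.filter (fun i => y i = c)).card : ℝ))
    (δ : ℝ) (hδ0 : 0 < δ) (hδ : δ ≤ (1 - r) * (μ2 - μ1))
    (hgap1 : ∀ i, ¬ (μ2 - δ ≤ y i ∧ y i < μ2))
    (hgap2 : ∀ i, ¬ (c - r * δ ≤ y i ∧ y i < c)) :
    (∑ i, tubeLoss t r (y i) μ1 (μ2 - δ)) - (∑ i, tubeLoss t r (y i) μ1 μ2)
      = δ * (t * (m1 + k1) - (1 - t) * (m2 + k2)) := by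
  rw [hm1, hk1, hm2, hk2, ← Finset.sum_sub_distrib,
    Finset.sum_congr rfl fun i _ =>
      tubeLoss_lower_upper_bound_sub hr hμ hc hδ0 hδ (hgap1 i) (hgap2 i)]
  simp only [← Finset.mul_sum, Finset.sum_sub_distrib, Finset.sum_add_distrib, Finset.sum_boole]
end

section
/- Lowering the lower bound: let δ > 0 satisfy (1−r)·δ < r·(μ2 − μ1), and suppose that no sample point y_i lies in the interval [μ1 − δ, μ1) and no sample point y_i lies in the interval [c − (1−r)·δ, c). Then the empirical risk satisfies the exact identity L(μ1 − δ, μ2) − L(μ1, μ2) = δ·[ (1−t)·(m3 + k3) − t·m4 ]. -/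
/-- Sample by sample, lowering the lower bound by `δ` changes the tube loss by `(1 - t) * δ` on
`[μ1, c)`, by `-(t * δ)` below `μ1`, and not at all elsewhere. -/
theorem tubeLoss_sub_lower_sub {t r y μ1 μ2 c δ : ℝ} (hr0 : 0 < r) (hr1 : r < 1) (hμ : μ1 < μ2)
    (hc : c = r * μ2 + (1 - r) * μ1) (hδ0 : 0 < δ)
    (hgap1 : ¬ (μ1 - δ ≤ y ∧ y < μ1)) (hgap2 : ¬ (c - (1 - r) * δ ≤ y ∧ y < c)) :
    tubeLoss t r y (μ1 - δ) μ2 - tubeLoss t r y μ1 μ2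
      = δ * ((1 - t) * ((if μ1 < y ∧ y < c then 1 else 0) + (if y = μ1 then 1 else 0))
        - t * (if y < μ1 then 1 else 0)) := by
  have hμc : μ1 < c := by nlinarith
  have hcμ : c < μ2 := by nlinarith
  have hcδ : r * μ2 + (1 - r) * (μ1 - δ) = c - (1 - r) * δ := by rw [hc]; ring
  have hcδc : c - (1 - r) * δ < c := by nlinarith
  unfold tubeLoss
  rw [hcδ, ← hc]
  split_ifs <;> grind

/-- Lowering the lower bound: if `δ > 0` with `(1−r)·δ < r·(μ2 − μ1)`, no sample lies in
`[μ1 − δ, μ1)` and none in `[c − (1−r)·δ, c)` with `c = r·μ2 + (1−r)·μ1`, then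
`L(μ1 − δ, μ2) − L(μ1, μ2) = δ·((1−t)·(m3 + k3) − t·m4)`. -/
theorem tubeLoss_risk_lower_lower_bound
    (t r : ℝ) (ht : t ∈ Set.Ioo (0 : ℝ) 1) (hr : r ∈ Set.Ioo (0 : ℝ) 1)
    (m : ℕ) (y : Fin m → ℝ) (μ1 μ2 c : ℝ) (hμ : μ1 < μ2)
    (hc : c = r * μ2 + (1 - r) * μ1)
    (m3 k3 m4 : ℝ)
    (hm3 : m3 = ((Finset.univ.filter (fun i => μ1 < y i ∧ y i < c)).card : ℝ))
    (hk3 : k3 = ((Finset.univ.filter (fun i => y i = μ1)).card : ℝ))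
    (hm4 : m4 = ((Finset.univ.filter (fun i => y i < μ1)).card : ℝ))
    (δ : ℝ) (hδ0 : 0 < δ) (hδ : (1 - r) * δ < r * (μ2 - μ1))
    (hgap1 : ∀ i, ¬ (μ1 - δ ≤ y i ∧ y i < μ1))
    (hgap2 : ∀ i, ¬ (c - (1 - r) * δ ≤ y i ∧ y i < c)) :
    (∑ i, tubeLoss t r (y i) (μ1 - δ) μ2) - (∑ i, tubeLoss t r (y i) μ1 μ2)
      = δ * ((1 - t) * (m3 + k3) - t * m4) := by
  rw [← Finset.sum_sub_distrib, hm3, hk3, hm4]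
  simp only [← Finset.sum_boole]
  rw [← Finset.sum_add_distrib, Finset.mul_sum, Finset.mul_sum, ← Finset.sum_sub_distrib,
    Finset.mul_sum]
  exact Finset.sum_congr rfl fun i _ =>
    tubeLoss_sub_lower_sub hr.1 hr.2 hμ hc hδ0 (hgap1 i) (hgap2 i)
end

section
/- Raising the upper bound: let δ > 0 satisfy r·δ < (1−r)·(μ2 − μ1), and suppose that no sample point y_i lies in the interval (μ2, μ2 + δ] and no sample point y_i lies in the interval (c, c + r·δ]. Then the empirical risk satisfies the exact identity L(μ1, μ2 + δ) − L(μ1, μ2) = δ·[ (1−t)·(m2 + k1) − t·m1 ] + (1−t)·k2·(2r − 1)·(μ2 − μ1). -/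
/-- The change of the tube loss of a single observation when the upper bound is raised by `δ`. -/
theorem tubeLoss_raise_upper_sub (t : ℝ) {r y μ1 μ2 c δ : ℝ} (hr : r ∈ Set.Ioo (0 : ℝ) 1)
    (hμ : μ1 < μ2) (hc : c = r * μ2 + (1 - r) * μ1)
    (hδ0 : 0 < δ) (hδ : r * δ < (1 - r) * (μ2 - μ1))
    (hgap1 : ¬ (μ2 < y ∧ y ≤ μ2 + δ)) (hgap2 : ¬ (c < y ∧ y ≤ c + r * δ)) :
    tubeLoss t r y μ1 (μ2 + δ) - tubeLoss t r y μ1 μ2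
      = δ * ((1 - t) * ((if c < y ∧ y < μ2 then 1 else 0) + (if y = μ2 then 1 else 0))
          - t * (if μ2 < y then 1 else 0))
        + (1 - t) * (if y = c then 1 else 0) * (2 * r - 1) * (μ2 - μ1) := by
  have hrδ : 0 < r * δ := mul_pos hr.1 hδ0
  have h1 : 0 < r * (μ2 - μ1) := mul_pos hr.1 (sub_pos.2 hμ)
  have hμ1c : μ1 < c := by linarith
  have hcμ2 : c + r * δ < μ2 := by linarith
  have hc' : r * (μ2 + δ) + (1 - r) * μ1 = c + r * δ := by rw [hc]; ring
  unfold tubeLoss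
  rw [hc', ← hc]
  rcases lt_trichotomy y c with h | rfl | h
  · have h2 : ¬ μ2 < y := by linarith
    have h3 : ¬ μ2 + δ < y := by linarith
    have h4 : ¬ c + r * δ ≤ y := by linarith
    have h5 : y ≠ μ2 := by intro h; linarith
    simp [h2, h3, h4, h5, h.not_gt, h.not_ge, h.ne]
  · have h2 : ¬ μ2 < y := by linarith
    have h3 : ¬ μ2 + δ < y := by linarith
    have h4 : ¬ y + r * δ ≤ y := by linarith
    have h5 : y ≠ μ2 := by intro h; linarith
    simp only [h2, h3, h4, h5, hμ1c.not_gt, lt_irrefl, le_refl, false_and, if_true, if_false]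
    linear_combination 2 * (1 - t) * hc
  · have h4 : c + r * δ ≤ y := (not_le.1 fun h' => hgap2 ⟨h, h'⟩).le
    have h6 : ¬ y < μ1 := by linarith
    rcases lt_trichotomy y μ2 with h' | rfl | h'
    · have h3 : ¬ μ2 + δ < y := by linarith
      simp only [h, h', h3, h4, h6, h.le, h.ne', h'.ne, h'.not_gt, and_self, if_true, if_false]
      ring
    · have h3 : ¬ y + δ < y := by linarith
      simp only [h, h3, h4, h6, h.le, h.ne', lt_irrefl, and_false, if_true, if_false]
      ring
    · have h3 : μ2 + δ < y := not_le.1 fun h'' => hgap1 ⟨h', h''⟩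
      simp only [h', h3, h.ne', h'.ne', h'.not_gt, and_false, if_true, if_false]
      ring

/-- Raising the upper bound: if `δ > 0` with `r·δ < (1−r)·(μ2 − μ1)`, no sample lies in
`(μ2, μ2 + δ]` and none in `(c, c + r·δ]` with `c = r·μ2 + (1−r)·μ1`, then
`L(μ1, μ2 + δ) − L(μ1, μ2) = δ·((1−t)·(m2 + k1) − t·m1) + (1−t)·k2·(2r − 1)·(μ2 − μ1)`. -/
theorem tubeLoss_risk_raise_upper_bound
    (t r : ℝ) (ht : t ∈ Set.Ioo (0 : ℝ) 1) (hr : r ∈ Set.Ioo (0 : ℝ) 1)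
    (m : ℕ) (y : Fin m → ℝ) (μ1 μ2 c : ℝ) (hμ : μ1 < μ2)
    (hc : c = r * μ2 + (1 - r) * μ1)
    (m1 k1 m2 k2 : ℝ)
    (hm1 : m1 = ((Finset.univ.filter (fun i => μ2 < y i)).card : ℝ))
    (hk1 : k1 = ((Finset.univ.filter (fun i => y i = μ2)).card : ℝ))
    (hm2 : m2 = ((Finset.univ.filter (fun i => c < y i ∧ y i < μ2)).card : ℝ))
    (hk2 : k2 = ((Finset.univ.filter (fun i => y i = c)).card : ℝ))
    (δ : ℝ) (hδ0 : 0 < δ) (hδ : r * δ < (1 - r) * (μ2 - μ1))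
    (hgap1 : ∀ i, ¬ (μ2 < y i ∧ y i ≤ μ2 + δ))
    (hgap2 : ∀ i, ¬ (c < y i ∧ y i ≤ c + r * δ)) :
    (∑ i, tubeLoss t r (y i) μ1 (μ2 + δ)) - (∑ i, tubeLoss t r (y i) μ1 μ2)
      = δ * ((1 - t) * (m2 + k1) - t * m1) + (1 - t) * k2 * (2 * r - 1) * (μ2 - μ1) := by
  rw [← Finset.sum_sub_distrib, Finset.sum_congr rfl fun i _ =>
    tubeLoss_raise_upper_sub t hr hμ hc hδ0 hδ (hgap1 i) (hgap2 i)]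
  simp only [hm1, hk1, hm2, hk2, Finset.sum_add_distrib, Finset.sum_sub_distrib,
    ← Finset.mul_sum, ← Finset.sum_mul, Finset.sum_boole]
end

section
/- Raising the lower bound: let δ satisfy 0 < δ ≤ r·(μ2 − μ1), and suppose that no sample point y_i lies in the interval (μ1, μ1 + δ] and no sample point y_i lies in the interval (c, c + (1−r)·δ]. Then the empirical risk satisfies the exact identity L(μ1 + δ, μ2) − L(μ1, μ2) = δ·[ t·(m4 + k3) − (1−t)·m3 ] + (1−t)·k2·( (2r − 1)·(μ2 − μ1) − δ ). -/
/-- The change of the tube loss at a single point when the lower bound is raised from `μ1` to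
`μ1 + δ`, written with indicators of the position of `y`. -/
lemma tubeLoss_raise_lower_bound_sub {t r y μ1 μ2 c δ : ℝ} (hr1 : r < 1)
    (hμ : μ1 < μ2) (hc : c = r * μ2 + (1 - r) * μ1) (hδ0 : 0 < δ) (hδ : δ ≤ r * (μ2 - μ1))
    (hgap1 : ¬ (μ1 < y ∧ y ≤ μ1 + δ)) (hgap2 : ¬ (c < y ∧ y ≤ c + (1 - r) * δ)) :
    tubeLoss t r y (μ1 + δ) μ2 - tubeLoss t r y μ1 μ2
      = δ * (t * ((if y < μ1 then 1 else 0) + (if y = μ1 then 1 else 0))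
          - (1 - t) * (if μ1 < y ∧ y < c then 1 else 0))
        + (1 - t) * (if y = c then 1 else 0) * ((2 * r - 1) * (μ2 - μ1) - δ) := by
  have hc1 : μ1 < c := by nlinarith
  have hc2 : c < μ2 := by nlinarith
  have hcδ : μ1 + δ ≤ c := by linarith
  have hs : 0 < (1 - r) * δ := mul_pos (by linarith) hδ0
  have hc' : r * μ2 + (1 - r) * (μ1 + δ) = c + (1 - r) * δ := by rw [hc]; ring
  unfold tubeLoss
  rw [hc', ← hc]
  rcases lt_trichotomy y μ1 with h | h | h
  · rw [if_neg (by linarith), if_pos (by linarith), if_neg (by linarith), if_pos h, if_pos h,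
      if_neg h.ne, if_neg (fun h' => by linarith [h'.1]), if_neg (by linarith)]
    ring
  · rw [if_neg (by linarith), if_pos (by linarith), if_neg (by linarith), if_neg (by linarith),
      if_neg (by linarith), if_neg (by linarith), if_pos h,
      if_neg (fun h' => by linarith [h'.1]), if_neg (by linarith), h]
    ring
  have hy : μ1 + δ < y := by
    by_contra! h'
    exact hgap1 ⟨h, h'⟩
  rw [if_neg (not_lt.2 hy.le), if_neg (not_lt.2 h.le), if_neg (not_lt.2 h.le), if_neg h.ne']
  rcases lt_trichotomy y c with h2 | h2 | h2
  · rw [if_neg (by linarith), if_neg (by linarith), if_neg (by linarith), if_neg (by linarith),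
      if_pos ⟨h, h2⟩, if_neg h2.ne]
    ring
  · rw [if_neg (by linarith), if_neg (by linarith), if_neg (by linarith), if_pos h2.ge,
      if_neg (fun h' => by linarith [h'.2]), if_pos h2, h2, hc]
    ring
  · have hy2 : c + (1 - r) * δ < y := by
      by_contra! h'
      exact hgap2 ⟨h2, h'⟩
    rw [if_pos hy2.le, if_pos h2.le, if_neg (fun h' : μ1 < y ∧ y < c => by linarith [h'.2]),
      if_neg h2.ne']
    ring

/-- Raising the lower bound: if `0 < δ ≤ r·(μ2 − μ1)`, no sample lies in
`(μ1, μ1 + δ]` and none in `(c, c + (1−r)·δ]` with `c = r·μ2 + (1−r)·μ1`, then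
`L(μ1 + δ, μ2) − L(μ1, μ2) = δ·(t·(m4 + k3) − (1−t)·m3) + (1−t)·k2·((2r − 1)·(μ2 − μ1) − δ)`. -/
theorem tubeLoss_risk_raise_lower_bound
    (t r : ℝ) (ht : t ∈ Set.Ioo (0 : ℝ) 1) (hr : r ∈ Set.Ioo (0 : ℝ) 1)
    (m : ℕ) (y : Fin m → ℝ) (μ1 μ2 c : ℝ) (hμ : μ1 < μ2)
    (hc : c = r * μ2 + (1 - r) * μ1)
    (k2 m3 k3 m4 : ℝ)
    (hk2 : k2 = ((Finset.univ.filter (fun i => y i = c)).card : ℝ))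
    (hm3 : m3 = ((Finset.univ.filter (fun i => μ1 < y i ∧ y i < c)).card : ℝ))
    (hk3 : k3 = ((Finset.univ.filter (fun i => y i = μ1)).card : ℝ))
    (hm4 : m4 = ((Finset.univ.filter (fun i => y i < μ1)).card : ℝ))
    (δ : ℝ) (hδ0 : 0 < δ) (hδ : δ ≤ r * (μ2 - μ1))
    (hgap1 : ∀ i, ¬ (μ1 < y i ∧ y i ≤ μ1 + δ))
    (hgap2 : ∀ i, ¬ (c < y i ∧ y i ≤ c + (1 - r) * δ)) :
    (∑ i, tubeLoss t r (y i) (μ1 + δ) μ2) - (∑ i, tubeLoss t r (y i) μ1 μ2)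
      = δ * (t * (m4 + k3) - (1 - t) * m3) + (1 - t) * k2 * ((2 * r - 1) * (μ2 - μ1) - δ) := by
  subst hk2 hm3 hk3 hm4
  rw [← Finset.sum_sub_distrib, Finset.sum_congr rfl fun i _ =>
    tubeLoss_raise_lower_bound_sub (t := t) hr.2 hμ hc hδ0 hδ (hgap1 i) (hgap2 i)]
  simp only [Finset.sum_add_distrib, Finset.sum_sub_distrib, ← Finset.mul_sum, ← Finset.sum_mul,
    Finset.sum_boole]
end

section
/- If (μ1, μ2) with μ1 < μ2 is a global minimizer of the empirical tube-loss risk L over {(a, b) ∈ ℝ² : a ≤ b}, then t·(m1 + k1) ≥ (1−t)·(m2 + k2). -/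
open Filter Topology in
/-- For small `ε > 0`, replacing `μ2` by `μ2 - ε` changes the tube loss linearly in `ε`. -/
lemma eventually_tubeLoss_sub_eq {r μ1 μ2 : ℝ} (t y : ℝ) (hr : r ∈ Set.Ioo (0 : ℝ) 1)
    (hμ : μ1 < μ2) :
    ∀ᶠ ε in 𝓝[>] (0 : ℝ), tubeLoss t r y μ1 (μ2 - ε) = tubeLoss t r y μ1 μ2 +
      ε * (t * ((if μ2 < y then 1 else 0) + (if y = μ2 then 1 else 0)) -
        (1 - t) * ((if r * μ2 + (1 - r) * μ1 < y ∧ y < μ2 then 1 else 0) +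
          (if y = r * μ2 + (1 - r) * μ1 then 1 else 0))) := by
  obtain ⟨hr0, hr1⟩ := hr
  have eventually_lt {d : ℝ} (hd : 0 < d) : ∀ᶠ ε in 𝓝[>] (0 : ℝ), ε < d :=
    eventually_nhdsWithin_of_eventually_nhds (eventually_lt_nhds hd)
  have hc1 : μ1 < r * μ2 + (1 - r) * μ1 := by nlinarith
  have hc2 : r * μ2 + (1 - r) * μ1 < μ2 := by nlinarith
  have hshift (ε : ℝ) : r * (μ2 - ε) + (1 - r) * μ1 = r * μ2 + (1 - r) * μ1 - r * ε := by ring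
  simp only [tubeLoss, hshift]
  generalize r * μ2 + (1 - r) * μ1 = c at *
  have hpos : ∀ᶠ ε in 𝓝[>] (0 : ℝ), 0 < ε := self_mem_nhdsWithin
  rcases lt_or_ge y c with hyc | hyc
  · filter_upwards [hpos, eventually_lt (sub_pos.2 hyc)] with ε hε hεc
    have hrε : r * ε < ε := by nlinarith
    rw [if_neg (by linarith : ¬ μ2 - ε < y), if_neg (by linarith : ¬ c - r * ε ≤ y),
      if_neg (by linarith : ¬ μ2 < y), if_neg (by linarith : ¬ c ≤ y),
      if_neg (by linarith : ¬ μ2 < y), if_neg (by linarith : ¬ y = μ2),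
      if_neg (fun h => by linarith [h.1] : ¬ (c < y ∧ y < μ2)), if_neg hyc.ne]
    ring
  rcases lt_or_ge y μ2 with hy | hy
  · filter_upwards [hpos, eventually_lt (sub_pos.2 hy)] with ε hε hεμ
    have hrε : 0 < r * ε := mul_pos hr0 hε
    have hcount : (if c < y ∧ y < μ2 then 1 else 0) + (if y = c then 1 else 0) = (1 : ℝ) := by
      rcases hyc.eq_or_lt with rfl | h
      · simp
      · simp [h, hy, h.ne']
    rw [hcount, if_neg (by linarith : ¬ μ2 - ε < y), if_pos (by linarith : c - r * ε ≤ y),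
      if_neg (by linarith : ¬ y < μ1), if_neg (by linarith : ¬ μ2 < y),
      if_neg (by linarith : ¬ y < μ1), if_pos hyc, if_neg (by linarith : ¬ μ2 < y),
      if_neg hy.ne]
    ring
  · filter_upwards [hpos] with ε hε
    rw [if_pos (by linarith : μ2 - ε < y),
      if_neg (fun h => by linarith [h.2] : ¬ (c < y ∧ y < μ2)),
      if_neg (by linarith : ¬ y = c)]
    rcases hy.eq_or_lt with rfl | h
    · simp [hc1.trans hc2 |>.not_gt, hc2.le]
      ring
    · simp [h, h.ne']
      ring

/-- If (μ1, μ2) with μ1 < μ2 globally minimizes the empirical tube-loss risk over {(a,b) : a ≤ b}, then t·(m1 + k1) ≥ (1−t)·(m2 + k2). -/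
theorem tubeLoss_minimizer_upper_ge
    (t r : ℝ) (ht : t ∈ Set.Ioo (0 : ℝ) 1) (hr : r ∈ Set.Ioo (0 : ℝ) 1)
    (m : ℕ) (y : Fin m → ℝ) (μ1 μ2 c : ℝ) (hμ : μ1 < μ2)
    (hc : c = r * μ2 + (1 - r) * μ1)
    (hmin : ∀ a b : ℝ, a ≤ b →
      (∑ i, tubeLoss t r (y i) μ1 μ2) ≤ ∑ i, tubeLoss t r (y i) a b)
    (m1 k1 m2 k2 m3 k3 m4 : ℝ)
    (hm1 : m1 = ((Finset.univ.filter (fun i => μ2 < y i)).card : ℝ))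
    (hk1 : k1 = ((Finset.univ.filter (fun i => y i = μ2)).card : ℝ))
    (hm2 : m2 = ((Finset.univ.filter (fun i => c < y i ∧ y i < μ2)).card : ℝ))
    (hk2 : k2 = ((Finset.univ.filter (fun i => y i = c)).card : ℝ))
    (hm3 : m3 = ((Finset.univ.filter (fun i => μ1 < y i ∧ y i < c)).card : ℝ))
    (hk3 : k3 = ((Finset.univ.filter (fun i => y i = μ1)).card : ℝ))
    (hm4 : m4 = ((Finset.univ.filter (fun i => y i < μ1)).card : ℝ)) :
    (1 - t) * (m2 + k2) ≤ t * (m1 + k1) := by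
  have hev := (Filter.eventually_all (l := nhdsWithin (0 : ℝ) (Set.Ioi 0))).2
    fun i => eventually_tubeLoss_sub_eq t (y i) hr hμ
  have hlt : ∀ᶠ ε in nhdsWithin (0 : ℝ) (Set.Ioi 0), ε < μ2 - μ1 :=
    eventually_nhdsWithin_of_eventually_nhds (eventually_lt_nhds (sub_pos.2 hμ))
  obtain ⟨ε, ⟨hloss, hεμ⟩, hε⟩ := ((hev.and hlt).and self_mem_nhdsWithin).exists
  have hle := hmin μ1 (μ2 - ε) (by linarith)
  simp only [hloss, ← hc, Finset.sum_add_distrib, Finset.sum_sub_distrib, ← Finset.mul_sum,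
    Finset.sum_boole, ← hm1, ← hk1, ← hm2, ← hk2] at hle
  have hnonneg := nonneg_of_mul_nonneg_right (le_add_iff_nonneg_right _ |>.1 hle) hε
  linarith
end

section
/- If (μ1, μ2) with μ1 < μ2 is a global minimizer of the empirical tube-loss risk L over {(a, b) ∈ ℝ² : a ≤ b}, then t·m4 ≤ (1−t)·(m3 + k3). -/
/-- Lowering the lower end of the tube by a small `δ` changes the loss of `y` by `-t δ` if `y` lies
below the tube, by `(1 - t) δ` if `y` lies in the lower part of the tube, and not at all
otherwise. -/
theorem tubeLoss_sub_lower {t r y μ1 μ2 δ : ℝ} (hr : r ∈ Set.Ioo (0 : ℝ) 1) (hμ : μ1 < μ2)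
    (hδ : 0 < δ) (h1 : y < μ1 → y < μ1 - δ)
    (h2 : y < r * μ2 + (1 - r) * μ1 → y < r * μ2 + (1 - r) * μ1 - δ) :
    tubeLoss t r y (μ1 - δ) μ2 = tubeLoss t r y μ1 μ2 +
      δ * ((1 - t) * ((if μ1 < y ∧ y < r * μ2 + (1 - r) * μ1 then 1 else 0) +
        (if y = μ1 then 1 else 0)) - t * (if y < μ1 then 1 else 0)) := by
  obtain ⟨hr0, hr1⟩ := hr
  have hc1 : μ1 < r * μ2 + (1 - r) * μ1 := by nlinarith
  have hc2 : r * μ2 + (1 - r) * μ1 < μ2 := by nlinarith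
  have hd : 0 < (1 - r) * δ := mul_pos (by linarith) hδ
  have hd' : 0 < r * δ := mul_pos hr0 hδ
  have hc' : r * μ2 + (1 - r) * (μ1 - δ) = r * μ2 + (1 - r) * μ1 - (1 - r) * δ := by ring
  have hrd : (1 - r) * δ = δ - r * δ := by ring
  unfold tubeLoss
  rw [hc']
  generalize r * μ2 + (1 - r) * μ1 = c at *
  rcases lt_trichotomy y μ1 with h | rfl | h
  · have := h1 h
    rw [if_neg (by linarith), if_pos this, if_neg (by linarith), if_pos h,
      if_neg (fun h' => by linarith [h'.1]), if_neg h.ne, if_pos h]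
    ring
  · have := h2 hc1
    rw [if_neg (by linarith), if_neg (by linarith), if_neg (by linarith), if_neg (by linarith),
      if_neg (by linarith), if_neg (by linarith), if_neg (fun h' => by linarith [h'.1]),
      if_pos rfl, if_neg (lt_irrefl _)]
    ring
  · rw [if_neg h.ne', if_neg h.not_gt, if_neg h.not_gt]
    rcases lt_or_ge y c with hy | hy
    · have := h2 hy
      rw [if_neg (by linarith), if_neg (by linarith), if_neg (by linarith), if_neg (by linarith),
        if_neg (by linarith), if_pos ⟨h, hy⟩]
      ring
    · rw [if_neg (by linarith : ¬ y < μ1 - δ), if_pos (by linarith : c - (1 - r) * δ ≤ y),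
        if_pos hy, if_neg (fun h' => hy.not_gt h'.2 : ¬ (μ1 < y ∧ y < c))]
      ring

/-- Finitely many strict inequalities `y i < a` persist after lowering `a` by a small amount. -/
theorem eventually_forall_lt_sub {ι : Type*} [Finite ι] (y : ι → ℝ) (a : ℝ) :
    ∀ᶠ δ in nhdsWithin (0 : ℝ) (Set.Ioi 0), ∀ i, y i < a → y i < a - δ := by
  refine Filter.eventually_all.2 fun i => ?_
  by_cases h : y i < a
  · filter_upwards [Ioo_mem_nhdsGT (sub_pos.2 h)] with δ hδ _
    linarith [hδ.2]
  · exact Filter.Eventually.of_forall fun _ h' => absurd h' h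

/-- If (μ1, μ2) with μ1 < μ2 globally minimizes the empirical tube-loss risk over {(a,b) : a ≤ b}, then t·m4 ≤ (1−t)·(m3 + k3). -/
theorem tubeLoss_minimizer_lower_le
    (t r : ℝ) (ht : t ∈ Set.Ioo (0 : ℝ) 1) (hr : r ∈ Set.Ioo (0 : ℝ) 1)
    (m : ℕ) (y : Fin m → ℝ) (μ1 μ2 c : ℝ) (hμ : μ1 < μ2)
    (hc : c = r * μ2 + (1 - r) * μ1)
    (hmin : ∀ a b : ℝ, a ≤ b →
      (∑ i, tubeLoss t r (y i) μ1 μ2) ≤ ∑ i, tubeLoss t r (y i) a b)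
    (m1 k1 m2 k2 m3 k3 m4 : ℝ)
    (hm1 : m1 = ((Finset.univ.filter (fun i => μ2 < y i)).card : ℝ))
    (hk1 : k1 = ((Finset.univ.filter (fun i => y i = μ2)).card : ℝ))
    (hm2 : m2 = ((Finset.univ.filter (fun i => c < y i ∧ y i < μ2)).card : ℝ))
    (hk2 : k2 = ((Finset.univ.filter (fun i => y i = c)).card : ℝ))
    (hm3 : m3 = ((Finset.univ.filter (fun i => μ1 < y i ∧ y i < c)).card : ℝ))
    (hk3 : k3 = ((Finset.univ.filter (fun i => y i = μ1)).card : ℝ))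
    (hm4 : m4 = ((Finset.univ.filter (fun i => y i < μ1)).card : ℝ)) :
    t * m4 ≤ (1 - t) * (m3 + k3) := by
  obtain ⟨δ, ⟨h1, h2⟩, hδ⟩ := (((eventually_forall_lt_sub y μ1).and
    (eventually_forall_lt_sub y c)).and self_mem_nhdsWithin).exists
  have hδ : 0 < δ := hδ
  subst hc
  have key := hmin (μ1 - δ) μ2 (by linarith)
  rw [Finset.sum_congr rfl fun i _ => tubeLoss_sub_lower hr hμ hδ (h1 i) (h2 i),
    Finset.sum_add_distrib, ← Finset.mul_sum, Finset.sum_sub_distrib, ← Finset.mul_sum,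
    ← Finset.mul_sum, Finset.sum_add_distrib, Finset.sum_boole, Finset.sum_boole,
    Finset.sum_boole, ← hm3, ← hk3, ← hm4] at key
  have := nonneg_of_mul_nonneg_right (le_of_add_le_add_left ((add_zero _).trans_le key)) hδ
  linarith
end

section
/- If (μ1, μ2) with μ1 < μ2 is a global minimizer of the empirical tube-loss risk L over {(a, b) ∈ ℝ² : a ≤ b}, and if moreover k2 = 0 or r ≤ 1/2, then t·m1 ≤ (1−t)·(m2 + k1). -/
open Filter Topology in
/-- Every strict inequality `a < y` survives a small increase of its left side. -/
theorem eventually_lt_imp_add_lt (a y : ℝ) : ∀ᶠ δ in 𝓝[>] (0 : ℝ), a < y → a + δ < y := by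
  by_cases h : a < y
  · filter_upwards [Ioo_mem_nhdsGT (sub_pos.2 h)] with δ hδ _
    linarith [hδ.2]
  · exact .of_forall fun _ h' => absurd h' h

/-- First-order bound on the change of the tube loss when the upper end of the tube is raised
by an amount `δ` too small to move an observation across the upper end or the split point from
above. -/
theorem tubeLoss_add_right_le {t r y a b δ : ℝ} (ht : t ∈ Set.Ioo (0 : ℝ) 1)
    (hr : r ∈ Set.Ioo (0 : ℝ) 1) (hab : a < b) (hδ : 0 < δ)
    (hb : b < y → b + δ < y)
    (hs : r * b + (1 - r) * a < y → r * b + (1 - r) * a + δ < y)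
    (hside : y ≠ r * b + (1 - r) * a ∨ r ≤ 1 / 2) :
    tubeLoss t r y a (b + δ) ≤ tubeLoss t r y a b +
      δ * ((1 - t) * ((if r * b + (1 - r) * a < y ∧ y < b then 1 else 0) +
        (if y = b then 1 else 0)) - t * (if b < y then 1 else 0)) := by
  obtain ⟨ht0, ht1⟩ := ht
  obtain ⟨hr0, hr1⟩ := hr
  have hrδ : 0 < r * δ := mul_pos hr0 hδ
  have hrδ' : 0 < (1 - r) * δ := mul_pos (sub_pos.2 hr1) hδ
  have hlow : 0 < r * (b - a) := mul_pos hr0 (sub_pos.2 hab)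
  have hhigh : 0 < (1 - r) * (b - a) := mul_pos (sub_pos.2 hr1) (sub_pos.2 hab)
  have hshift : r * (b + δ) + (1 - r) * a = r * b + (1 - r) * a + r * δ := by ring
  unfold tubeLoss
  rw [hshift]
  rcases lt_trichotomy y (r * b + (1 - r) * a) with h | h | h
  · simp only [if_neg (by linarith : ¬ b + δ < y), if_neg (by linarith : ¬ b < y),
      if_neg (by linarith : ¬ r * b + (1 - r) * a + r * δ ≤ y), if_neg h.not_ge,
      if_neg (fun k : _ < y ∧ y < b => h.not_gt k.1), if_neg (by linarith : ¬ y = b)]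
    linarith
  · have hr2 : r ≤ 1 / 2 := hside.resolve_left (not_not_intro h)
    have hle : y - a ≤ b - y := by
      have := mul_nonneg (by linarith : 0 ≤ 1 - 2 * r) (sub_pos.2 hab).le
      linarith
    simp only [if_neg (by linarith : ¬ b + δ < y), if_neg (by linarith : ¬ b < y),
      if_neg (by linarith : ¬ y < a),
      if_neg (by linarith : ¬ r * b + (1 - r) * a + r * δ ≤ y), if_pos h.ge,
      if_neg (fun k : _ < y ∧ y < b => k.1.ne h.symm), if_neg (by linarith : ¬ y = b)]
    have := mul_le_mul_of_nonneg_left hle (sub_pos.2 ht1).le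
    linarith
  · have hs' := hs h
    have hya : ¬ y < a := by linarith
    have hsplit : r * b + (1 - r) * a + r * δ ≤ y := by linarith
    rcases lt_trichotomy y b with h' | h' | h'
    · simp only [if_neg hya, if_neg h'.not_gt, if_neg (by linarith : ¬ b + δ < y), if_pos hsplit,
        if_pos h.le, if_pos (And.intro h h'), if_neg h'.ne]
      linarith
    · simp only [if_neg hya, if_neg h'.not_gt, if_neg (by linarith : ¬ b + δ < y), if_pos hsplit,
        if_pos h.le, if_pos h', if_neg (fun k : _ ∧ y < b => k.2.ne h')]
      linarith
    · simp only [if_pos h', if_pos (hb h'), if_neg h'.ne',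
        if_neg (fun k : _ ∧ y < b => k.2.not_gt h')]
      linarith

/-- If (μ1, μ2) with μ1 < μ2 globally minimizes the empirical tube-loss risk over {(a,b) : a ≤ b}, and k2 = 0 or r ≤ 1/2, then t·m1 ≤ (1−t)·(m2 + k1). -/
theorem tubeLoss_minimizer_upper_le
    (t r : ℝ) (ht : t ∈ Set.Ioo (0 : ℝ) 1) (hr : r ∈ Set.Ioo (0 : ℝ) 1)
    (m : ℕ) (y : Fin m → ℝ) (μ1 μ2 c : ℝ) (hμ : μ1 < μ2)
    (hc : c = r * μ2 + (1 - r) * μ1)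
    (hmin : ∀ a b : ℝ, a ≤ b →
      (∑ i, tubeLoss t r (y i) μ1 μ2) ≤ ∑ i, tubeLoss t r (y i) a b)
    (m1 k1 m2 k2 m3 k3 m4 : ℝ)
    (hm1 : m1 = ((Finset.univ.filter (fun i => μ2 < y i)).card : ℝ))
    (hk1 : k1 = ((Finset.univ.filter (fun i => y i = μ2)).card : ℝ))
    (hm2 : m2 = ((Finset.univ.filter (fun i => c < y i ∧ y i < μ2)).card : ℝ))
    (hk2 : k2 = ((Finset.univ.filter (fun i => y i = c)).card : ℝ))
    (hm3 : m3 = ((Finset.univ.filter (fun i => μ1 < y i ∧ y i < c)).card : ℝ))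
    (hk3 : k3 = ((Finset.univ.filter (fun i => y i = μ1)).card : ℝ))
    (hm4 : m4 = ((Finset.univ.filter (fun i => y i < μ1)).card : ℝ))
    (hside : k2 = 0 ∨ r ≤ 1 / 2) :
    t * m1 ≤ (1 - t) * (m2 + k1) := by
  subst hc
  have hside' : ∀ i, y i ≠ r * μ2 + (1 - r) * μ1 ∨ r ≤ 1 / 2 := fun i =>
    hside.imp_left fun h0 hi => by
      rw [hk2, Nat.cast_eq_zero, Finset.card_eq_zero] at h0
      exact Finset.notMem_empty i (h0 ▸ Finset.mem_filter.2 ⟨Finset.mem_univ i, hi⟩)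
  obtain ⟨δ, hδ, hb, hs⟩ := (eventually_mem_nhdsWithin.and
    ((Filter.eventually_all.2 fun i => eventually_lt_imp_add_lt μ2 (y i)).and
      (Filter.eventually_all.2 fun i =>
        eventually_lt_imp_add_lt (r * μ2 + (1 - r) * μ1) (y i)))).exists
  have hδ0 : 0 < δ := hδ
  have hsum := (hmin μ1 (μ2 + δ) (by linarith)).trans (Finset.sum_le_sum fun i _ =>
    tubeLoss_add_right_le ht hr hμ hδ0 (hb i) (hs i) (hside' i))
  rw [Finset.sum_add_distrib, ← Finset.mul_sum, Finset.sum_sub_distrib, ← Finset.mul_sum,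
    ← Finset.mul_sum, Finset.sum_add_distrib, Finset.sum_boole, Finset.sum_boole,
    Finset.sum_boole, ← hm1, ← hk1, ← hm2] at hsum
  linarith [nonneg_of_mul_nonneg_right (le_add_iff_nonneg_right _ |>.1 hsum) hδ0]
end

section
/- If (μ1, μ2) with μ1 < μ2 is a global minimizer of the empirical tube-loss risk L over {(a, b) ∈ ℝ² : a ≤ b}, and if moreover k2 = 0 or r ≤ 1/2, then t·(m4 + k3) ≥ (1−t)·m3. -/
open Filter Topology in
/-- Raising the lower end of the tube by a small `δ > 0` changes the loss at `y` by at most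
`t * δ` if `y ≤ μ1`, by at most `-(1 - t) * δ` if `y` lies strictly between `μ1` and the
switching point, and does not increase it otherwise. -/
lemma eventually_tubeLoss_add_le {t r y μ1 μ2 : ℝ} (ht : t ∈ Set.Ioo (0 : ℝ) 1)
    (hr : r ∈ Set.Ioo (0 : ℝ) 1) (hμ : μ1 < μ2)
    (hside : y ≠ r * μ2 + (1 - r) * μ1 ∨ r ≤ 1 / 2) :
    ∀ᶠ δ in 𝓝[>] (0 : ℝ), tubeLoss t r y (μ1 + δ) μ2 ≤ tubeLoss t r y μ1 μ2 +
      δ * (t * ((if y < μ1 then 1 else 0) + if y = μ1 then 1 else 0) -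
        (1 - t) * if μ1 < y ∧ y < r * μ2 + (1 - r) * μ1 then 1 else 0) := by
  obtain ⟨ht0, ht1⟩ := ht
  obtain ⟨hr0, hr1⟩ := hr
  have hsmall (x : ℝ) : ∀ᶠ δ in 𝓝[>] (0 : ℝ), 0 < x → δ < x := by
    by_cases hx : 0 < x
    · filter_upwards [Ioo_mem_nhdsGT hx] with δ hδ _ using hδ.2
    · exact Eventually.of_forall fun _ h => absurd h hx
  filter_upwards [self_mem_nhdsWithin, hsmall (y - μ1),
    hsmall (y - (r * μ2 + (1 - r) * μ1))] with δ hδ h1 h2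
  replace hδ : 0 < δ := hδ
  have hrw : 0 < r * (μ2 - μ1) := mul_pos hr0 (sub_pos.2 hμ)
  have hrw' : 0 < (1 - r) * (μ2 - μ1) := mul_pos (sub_pos.2 hr1) (sub_pos.2 hμ)
  have hrδ : 0 < r * δ := mul_pos hr0 hδ
  have hrδ' : 0 < (1 - r) * δ := mul_pos (sub_pos.2 hr1) hδ
  have htδ : 0 < (1 - t) * δ := mul_pos (sub_pos.2 ht1) hδ
  unfold tubeLoss
  rcases lt_trichotomy y μ1 with h | h | h
  · rw [if_neg (by linarith), if_pos (by linarith), if_neg (by linarith), if_pos h,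
      if_pos h, if_neg h.ne, if_neg (fun h' => by linarith [h'.1])]
    linarith
  · rw [if_neg (by linarith), if_pos (by linarith), if_neg (by linarith), if_neg (by linarith),
      if_neg (by linarith), if_neg (by linarith), if_pos h, if_neg (fun h' => by linarith [h'.1]),
      h]
    linarith
  have h1 := h1 (by linarith)
  rw [if_neg h.not_gt, if_neg h.not_gt, if_neg h.ne']
  by_cases hy2 : μ2 < y
  · rw [if_pos hy2, if_pos hy2, if_neg (fun h' => by linarith [h'.2])]
    linarith
  rw [if_neg hy2, if_neg hy2, if_neg (by linarith)]
  rcases lt_trichotomy y (r * μ2 + (1 - r) * μ1) with hc | hc | hc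
  · rw [if_neg (by linarith), if_neg (by linarith), if_pos ⟨h, hc⟩]
    linarith
  · have hr2 : r ≤ 1 / 2 := hside.resolve_left (not_not.2 hc)
    rw [if_neg (by linarith), if_pos hc.ge, if_neg (fun h' => by linarith [h'.2])]
    have : (1 - t) * (y - (μ1 + δ)) ≤ (1 - t) * (μ2 - y) :=
      mul_le_mul_of_nonneg_left (by nlinarith) (by linarith)
    linarith
  · have h2 := h2 (by linarith)
    rw [if_pos (by linarith), if_pos hc.le, if_neg (fun h' => by linarith [h'.2])]
    linarith

/-- If (μ1, μ2) with μ1 < μ2 globally minimizes the empirical tube-loss risk over {(a,b) : a ≤ b}, and k2 = 0 or r ≤ 1/2, then t·(m4 + k3) ≥ (1−t)·m3. -/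
theorem tubeLoss_minimizer_lower_ge
    (t r : ℝ) (ht : t ∈ Set.Ioo (0 : ℝ) 1) (hr : r ∈ Set.Ioo (0 : ℝ) 1)
    (m : ℕ) (y : Fin m → ℝ) (μ1 μ2 c : ℝ) (hμ : μ1 < μ2)
    (hc : c = r * μ2 + (1 - r) * μ1)
    (hmin : ∀ a b : ℝ, a ≤ b →
      (∑ i, tubeLoss t r (y i) μ1 μ2) ≤ ∑ i, tubeLoss t r (y i) a b)
    (m1 k1 m2 k2 m3 k3 m4 : ℝ)
    (hm1 : m1 = ((Finset.univ.filter (fun i => μ2 < y i)).card : ℝ))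
    (hk1 : k1 = ((Finset.univ.filter (fun i => y i = μ2)).card : ℝ))
    (hm2 : m2 = ((Finset.univ.filter (fun i => c < y i ∧ y i < μ2)).card : ℝ))
    (hk2 : k2 = ((Finset.univ.filter (fun i => y i = c)).card : ℝ))
    (hm3 : m3 = ((Finset.univ.filter (fun i => μ1 < y i ∧ y i < c)).card : ℝ))
    (hk3 : k3 = ((Finset.univ.filter (fun i => y i = μ1)).card : ℝ))
    (hm4 : m4 = ((Finset.univ.filter (fun i => y i < μ1)).card : ℝ))
    (hside : k2 = 0 ∨ r ≤ 1 / 2) :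
    (1 - t) * m3 ≤ t * (m4 + k3) := by
  subst hc
  have hpt : ∀ i, y i ≠ r * μ2 + (1 - r) * μ1 ∨ r ≤ 1 / 2 := by
    refine fun i => hside.imp_left fun h hi => ?_
    rw [hk2, Nat.cast_eq_zero, Finset.card_eq_zero] at h
    exact Finset.notMem_empty i (h ▸ Finset.mem_filter.2 ⟨Finset.mem_univ i, hi⟩)
  obtain ⟨δ, hle, hδ⟩ := ((Filter.eventually_all.2 fun i =>
    eventually_tubeLoss_add_le ht hr hμ (hpt i)).and
      (Ioo_mem_nhdsGT (sub_pos.2 hμ))).exists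
  have hsum := (hmin (μ1 + δ) μ2 (by linarith [hδ.2])).trans
    (Finset.sum_le_sum fun i _ => hle i)
  simp only [Finset.sum_add_distrib, ← Finset.mul_sum, Finset.sum_sub_distrib,
    Finset.sum_boole, ← hm3, ← hk3, ← hm4] at hsum
  have := nonneg_of_mul_nonneg_right (le_add_iff_nonneg_right _ |>.1 hsum) hδ.1
  linarith
end

section
/- Finite-sample balance: if (μ1, μ2) with μ1 < μ2 is a global minimizer of the empirical tube-loss risk L over {(a, b) ∈ ℝ² : a ≤ b}, and if moreover k2 = 0 or r ≤ 1/2, then |t·m1 − (1−t)·m2| ≤ k1 and |t·m4 − (1−t)·m3| ≤ k3. -/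
/-- `e` is smaller than every nonzero gap among `y`, the tube boundaries `a`, `b` and the
switching point `c`. -/
structure SmallStep (y a c b e : ℝ) : Prop where
  pos : 0 < e
  lt_width : e < b - a
  lt_sub_upper : 0 < y - b → e < y - b
  lt_upper_sub : 0 < b - y → e < b - y
  lt_sub_mid : 0 < y - c → e < y - c
  lt_mid_sub : 0 < c - y → e < c - y
  lt_sub_lower : 0 < y - a → e < y - a
  lt_lower_sub : 0 < a - y → e < a - y

open Filter Topology in
theorem eventually_smallStep {y a c b : ℝ} (hab : a < b) :
    ∀ᶠ e in 𝓝[>] (0 : ℝ), SmallStep y a c b e := by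
  have small (x : ℝ) : ∀ᶠ e in 𝓝[>] (0 : ℝ), 0 < x → e < x := by
    by_cases hx : 0 < x
    · filter_upwards [Ioo_mem_nhdsGT hx] with e he _ using he.2
    · exact Eventually.of_forall fun _ h => absurd h hx
  filter_upwards [self_mem_nhdsWithin, small (b - a), small (y - b), small (b - y),
    small (y - c), small (c - y), small (y - a), small (a - y)] with e h0 h1 h2 h3 h4 h5 h6 h7
  exact ⟨h0, h1 (sub_pos.2 hab), h2, h3, h4, h5, h6, h7⟩

/-- Linear upper bounds that hold for arbitrarily small steps give a nonnegative total slope at a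
minimizer. -/
theorem sum_slope_nonneg {m : ℕ} {y : Fin m → ℝ} {a c b : ℝ} (hab : a < b)
    {F : ℝ → Fin m → ℝ} {f g : Fin m → ℝ}
    (hmin : ∀ e, 0 < e → e < b - a → ∑ i, f i ≤ ∑ i, F e i)
    (hF : ∀ i e, SmallStep (y i) a c b e → F e i ≤ f i + e * g i) : 0 ≤ ∑ i, g i := by
  obtain ⟨e, he, h0, hw⟩ := ((Filter.eventually_all.2 fun i =>
    eventually_smallStep (y := y i) (c := c) hab).and
      (Ioo_mem_nhdsGT (sub_pos.2 hab))).exists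
  have h := (hmin e h0 hw).trans (Finset.sum_le_sum fun i _ => hF i e (he i))
  rw [Finset.sum_add_distrib, ← Finset.mul_sum] at h
  exact nonneg_of_mul_nonneg_right (by linarith) h0

section Pointwise

variable {t r y a c b e : ℝ}

theorem tubeLoss_raise_upper_le (ht : t ∈ Set.Ioo (0 : ℝ) 1) (hr : r ∈ Set.Ioo (0 : ℝ) 1)
    (hab : a < b) (hc : c = r * b + (1 - r) * a) (hside : y ≠ c ∨ r ≤ 1 / 2)
    (he : SmallStep y a c b e) :
    tubeLoss t r y a (b + e) ≤ tubeLoss t r y a b + e *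
      ((if b < y then -t else 0) + (if y = b then 1 - t else 0)
        + (if c < y ∧ y < b then 1 - t else 0)) := by
  obtain ⟨ht0, ht1⟩ := ht
  obtain ⟨hr0, hr1⟩ := hr
  obtain ⟨h0, h1, h2, h3, h4, h5, h6, h7⟩ := he
  have hre : 0 < r * e := mul_pos hr0 h0
  have hre' : 0 < (1 - r) * e := mul_pos (sub_pos.2 hr1) h0
  have hac : a < c := by nlinarith
  have hcb : c < b := by nlinarith
  have hswitch : r ≤ 1 / 2 → (1 - t) * (c - a) ≤ (1 - t) * (b - c) := fun h =>
    mul_le_mul_of_nonneg_left (by nlinarith) (sub_pos.2 ht1).le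
  unfold tubeLoss
  split_ifs <;> grind

theorem tubeLoss_lower_upper_le (ht : t ∈ Set.Ioo (0 : ℝ) 1) (hr : r ∈ Set.Ioo (0 : ℝ) 1)
    (hab : a < b) (hc : c = r * b + (1 - r) * a)
    (he : SmallStep y a c b e) :
    tubeLoss t r y a (b - e) ≤ tubeLoss t r y a b + e *
      ((if b < y then t else 0) + (if y = b then t else 0)
        + (if c < y ∧ y < b then -(1 - t) else 0)) := by
  obtain ⟨ht0, ht1⟩ := ht
  obtain ⟨hr0, hr1⟩ := hr
  obtain ⟨h0, h1, h2, h3, h4, h5, h6, h7⟩ := he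
  have hre : 0 < r * e := mul_pos hr0 h0
  have hre' : 0 < (1 - r) * e := mul_pos (sub_pos.2 hr1) h0
  have hac : a < c := by nlinarith
  have hcb : c < b := by nlinarith
  have hte : 0 < (1 - t) * e := mul_pos (sub_pos.2 ht1) h0
  unfold tubeLoss
  split_ifs <;> grind

theorem tubeLoss_raise_lower_le (ht : t ∈ Set.Ioo (0 : ℝ) 1) (hr : r ∈ Set.Ioo (0 : ℝ) 1)
    (hab : a < b) (hc : c = r * b + (1 - r) * a) (hside : y ≠ c ∨ r ≤ 1 / 2)
    (he : SmallStep y a c b e) :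
    tubeLoss t r y (a + e) b ≤ tubeLoss t r y a b + e *
      ((if y < a then t else 0) + (if y = a then t else 0)
        + (if a < y ∧ y < c then -(1 - t) else 0)) := by
  obtain ⟨ht0, ht1⟩ := ht
  obtain ⟨hr0, hr1⟩ := hr
  obtain ⟨h0, h1, h2, h3, h4, h5, h6, h7⟩ := he
  have hre : 0 < r * e := mul_pos hr0 h0
  have hre' : 0 < (1 - r) * e := mul_pos (sub_pos.2 hr1) h0
  have hac : a < c := by nlinarith
  have hcb : c < b := by nlinarith
  have hte : 0 < (1 - t) * e := mul_pos (sub_pos.2 ht1) h0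
  have hswitch : r ≤ 1 / 2 → (1 - t) * (c - a) ≤ (1 - t) * (b - c) := fun h =>
    mul_le_mul_of_nonneg_left (by nlinarith) (sub_pos.2 ht1).le
  unfold tubeLoss
  split_ifs <;> grind

theorem tubeLoss_lower_lower_le (ht : t ∈ Set.Ioo (0 : ℝ) 1) (hr : r ∈ Set.Ioo (0 : ℝ) 1)
    (hab : a < b) (hc : c = r * b + (1 - r) * a)
    (he : SmallStep y a c b e) :
    tubeLoss t r y (a - e) b ≤ tubeLoss t r y a b + e *
      ((if y < a then -t else 0) + (if y = a then 1 - t else 0)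
        + (if a < y ∧ y < c then 1 - t else 0)) := by
  obtain ⟨ht0, ht1⟩ := ht
  obtain ⟨hr0, hr1⟩ := hr
  obtain ⟨h0, h1, h2, h3, h4, h5, h6, h7⟩ := he
  have hre : 0 < r * e := mul_pos hr0 h0
  have hre' : 0 < (1 - r) * e := mul_pos (sub_pos.2 hr1) h0
  have hac : a < c := by nlinarith
  have hcb : c < b := by nlinarith
  unfold tubeLoss
  split_ifs <;> grind

end Pointwise

/-- Finite-sample balance: if (μ1, μ2) with μ1 < μ2 globally minimizes the empirical tube-loss risk over {(a,b) : a ≤ b}, and k2 = 0 or r ≤ 1/2, then |t·m1 − (1−t)·m2| ≤ k1 and |t·m4 − (1−t)·m3| ≤ k3. -/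
theorem tubeLoss_minimizer_balance
    (t r : ℝ) (ht : t ∈ Set.Ioo (0 : ℝ) 1) (hr : r ∈ Set.Ioo (0 : ℝ) 1)
    (m : ℕ) (y : Fin m → ℝ) (μ1 μ2 c : ℝ) (hμ : μ1 < μ2)
    (hc : c = r * μ2 + (1 - r) * μ1)
    (hmin : ∀ a b : ℝ, a ≤ b →
      (∑ i, tubeLoss t r (y i) μ1 μ2) ≤ ∑ i, tubeLoss t r (y i) a b)
    (m1 k1 m2 k2 m3 k3 m4 : ℝ)
    (hm1 : m1 = ((Finset.univ.filter (fun i => μ2 < y i)).card : ℝ))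
    (hk1 : k1 = ((Finset.univ.filter (fun i => y i = μ2)).card : ℝ))
    (hm2 : m2 = ((Finset.univ.filter (fun i => c < y i ∧ y i < μ2)).card : ℝ))
    (hk2 : k2 = ((Finset.univ.filter (fun i => y i = c)).card : ℝ))
    (hm3 : m3 = ((Finset.univ.filter (fun i => μ1 < y i ∧ y i < c)).card : ℝ))
    (hk3 : k3 = ((Finset.univ.filter (fun i => y i = μ1)).card : ℝ))
    (hm4 : m4 = ((Finset.univ.filter (fun i => y i < μ1)).card : ℝ))
    (hside : k2 = 0 ∨ r ≤ 1 / 2) :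
    |t * m1 - (1 - t) * m2| ≤ k1 ∧ |t * m4 - (1 - t) * m3| ≤ k3 := by
  have hside' (i : Fin m) : y i ≠ c ∨ r ≤ 1 / 2 := by
    refine hside.imp_left fun h hi => ?_
    rw [hk2, Nat.cast_eq_zero, Finset.card_eq_zero, Finset.filter_eq_empty_iff] at h
    exact h (Finset.mem_univ i) hi
  have raise_upper := sum_slope_nonneg hμ
    (fun e h0 _ => hmin μ1 (μ2 + e) (by linarith))
    (fun i _ he => tubeLoss_raise_upper_le ht hr hμ hc (hside' i) he)
  have lower_upper := sum_slope_nonneg hμ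
    (fun e _ hw => hmin μ1 (μ2 - e) (by linarith))
    (fun _ _ he => tubeLoss_lower_upper_le ht hr hμ hc he)
  have raise_lower := sum_slope_nonneg hμ
    (fun e _ hw => hmin (μ1 + e) μ2 (by linarith))
    (fun i _ he => tubeLoss_raise_lower_le ht hr hμ hc (hside' i) he)
  have lower_lower := sum_slope_nonneg hμ
    (fun e h0 _ => hmin (μ1 - e) μ2 (by linarith))
    (fun _ _ he => tubeLoss_lower_lower_le ht hr hμ hc he)
  simp only [Finset.sum_add_distrib, Finset.sum_ite, Finset.sum_const, mul_zero,
    add_zero, nsmul_eq_mul, ← hm1, ← hk1, ← hm2, ← hm3, ← hk3, ← hm4]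
    at raise_upper lower_upper raise_lower lower_lower
  have hk1' : 0 ≤ k1 := hk1 ▸ Nat.cast_nonneg _
  have hk3' : 0 ≤ k3 := hk3 ▸ Nat.cast_nonneg _
  obtain ⟨ht0, ht1⟩ := ht
  constructor <;> rw [abs_le] <;> constructor <;> nlinarith
end

section
/- Unconditional weighted balance: if (μ1, μ2) with μ1 < μ2 is a global minimizer of the empirical tube-loss risk L over {(a, b) ∈ ℝ² : a ≤ b}, then | t·((1−r)·m1 + r·m4) − (1−t)·((1−r)·m2 + r·m3) | ≤ (1−r)·(k1 + k2) + r·k3. (This is obtained by perturbing μ1 and μ2 simultaneously in opposite directions so that the separating level c = r·μ2 + (1−r)·μ1 is kept fixed.) -/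
open Finset Filter Topology in
/-- If a sum does not decrease along small one-sided perturbations, then slopes that bound its
terms to first order have nonnegative sum. -/
lemma sum_slope_nonneg_of_eventually_le {ι : Type*} [Fintype ι] (f : ι → ℝ → ℝ) (f₀ w : ι → ℝ)
    (hle : ∀ i, ∀ᶠ δ in 𝓝[>] (0 : ℝ), f i δ ≤ f₀ i + δ * w i)
    (hmin : ∀ᶠ δ in 𝓝[>] (0 : ℝ), ∑ i, f₀ i ≤ ∑ i, f i δ) : 0 ≤ ∑ i, w i := by
  obtain ⟨δ, ⟨hδ, hm⟩, hpos⟩ :=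
    (((eventually_all.2 hle).and hmin).and self_mem_nhdsWithin).exists
  have hsum := hm.trans (sum_le_sum fun i _ => hδ i)
  rw [sum_add_distrib, ← mul_sum] at hsum
  exact nonneg_of_mul_nonneg_right (by linarith) hpos

/-- The contribution of a single observation to the weighted imbalance. -/
noncomputable def tubeImbalance (t r μ1 μ2 c y : ℝ) : ℝ :=
  t * ((1 - r) * (if μ2 < y then 1 else 0) + r * (if y < μ1 then 1 else 0))
    - (1 - t) * ((1 - r) * (if c < y ∧ y < μ2 then 1 else 0)
      + r * (if μ1 < y ∧ y < c then 1 else 0))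

/-- The contribution of a single observation to the weighted number of ties. -/
noncomputable def tubeTies (r μ1 μ2 c y : ℝ) : ℝ :=
  (1 - r) * ((if y = μ2 then 1 else 0) + (if y = c then 1 else 0))
    + r * (if y = μ1 then 1 else 0)

open Filter Topology in
lemma eventually_eq_or_lt_sub_or_add_lt (x a : ℝ) :
    ∀ᶠ δ in 𝓝[>] (0 : ℝ), x = a ∨ x < a - δ ∨ a + δ < x := by
  rcases lt_trichotomy x a with h | h | h
  · filter_upwards [Ioo_mem_nhdsGT (sub_pos.2 h)] with δ hδ
    exact Or.inr (Or.inl (lt_sub_comm.1 hδ.2))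
  · simp [h]
  · filter_upwards [Ioo_mem_nhdsGT (sub_pos.2 h)] with δ hδ
    exact Or.inr (Or.inr (lt_sub_iff_add_lt'.1 hδ.2))

open Filter Topology in
lemma tubeLoss_widen_eventually_le {t r μ1 μ2 : ℝ} (ht : t ∈ Set.Ioo (0 : ℝ) 1)
    (hr : r ∈ Set.Ioo (0 : ℝ) 1) (hμ : μ1 < μ2) (y : ℝ) :
    ∀ᶠ δ in 𝓝[>] (0 : ℝ), tubeLoss t r y (μ1 - r * δ) (μ2 + (1 - r) * δ) ≤
      tubeLoss t r y μ1 μ2 + δ * (tubeTies r μ1 μ2 (r * μ2 + (1 - r) * μ1) y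
        - tubeImbalance t r μ1 μ2 (r * μ2 + (1 - r) * μ1) y) := by
  obtain ⟨ht0, ht1⟩ := ht
  obtain ⟨hr0, hr1⟩ := hr
  filter_upwards [self_mem_nhdsWithin, eventually_eq_or_lt_sub_or_add_lt y μ1,
    eventually_eq_or_lt_sub_or_add_lt y μ2] with δ hδ h1 h2
  rw [Set.mem_Ioi] at hδ
  have hc' : r * (μ2 + (1 - r) * δ) + (1 - r) * (μ1 - r * δ) = r * μ2 + (1 - r) * μ1 := by
    ring
  have hp : 0 < r * δ := by positivity
  have hq : 0 < (1 - r) * δ := mul_pos (by linarith) hδ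
  have hpδ : r * δ < δ := by nlinarith
  have hqδ : (1 - r) * δ < δ := by nlinarith
  have hμc : μ1 < r * μ2 + (1 - r) * μ1 := by nlinarith
  have hcμ : r * μ2 + (1 - r) * μ1 < μ2 := by nlinarith
  have htp := mul_pos ht0 hp
  have htq := mul_pos ht0 hq
  have htp' := mul_pos (sub_pos.2 ht1) hp
  have htq' := mul_pos (sub_pos.2 ht1) hq
  unfold tubeLoss tubeTies tubeImbalance
  rw [hc']
  generalize hc : r * μ2 + (1 - r) * μ1 = c at hμc hcμ ⊢
  clear hc hc'
  have hy : y < μ1 - δ ∨ y = μ1 ∨ (μ1 + δ < y ∧ y < c) ∨ y = c ∨ (c < y ∧ y < μ2 - δ) ∨ y = μ2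
      ∨ μ2 + δ < y := by
    clear hp hq hpδ hqδ htp htq htp' htq' ht0 ht1 hr0 hr1
    grind
  clear h1 h2
  rcases hy with h | h | ⟨h, h'⟩ | h | ⟨h, h'⟩ | h | h <;>
    simp (disch := grind) only [if_pos, if_neg] <;>
    try linarith

open Filter Topology in
lemma tubeLoss_narrow_eventually_le {t r μ1 μ2 : ℝ} (ht : t ∈ Set.Ioo (0 : ℝ) 1)
    (hr : r ∈ Set.Ioo (0 : ℝ) 1) (hμ : μ1 < μ2) (y : ℝ) :
    ∀ᶠ δ in 𝓝[>] (0 : ℝ), tubeLoss t r y (μ1 + r * δ) (μ2 - (1 - r) * δ) ≤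
      tubeLoss t r y μ1 μ2 + δ * (tubeTies r μ1 μ2 (r * μ2 + (1 - r) * μ1) y
        + tubeImbalance t r μ1 μ2 (r * μ2 + (1 - r) * μ1) y) := by
  obtain ⟨ht0, ht1⟩ := ht
  obtain ⟨hr0, hr1⟩ := hr
  filter_upwards [Ioo_mem_nhdsGT (sub_pos.2 hμ), eventually_eq_or_lt_sub_or_add_lt y μ1,
    eventually_eq_or_lt_sub_or_add_lt y μ2] with δ hδ h1 h2
  obtain ⟨hδ, hδμ⟩ := hδ
  have hc' : r * (μ2 - (1 - r) * δ) + (1 - r) * (μ1 + r * δ) = r * μ2 + (1 - r) * μ1 := by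
    ring
  have hp : 0 < r * δ := by positivity
  have hq : 0 < (1 - r) * δ := mul_pos (by linarith) hδ
  have hpδ : r * δ < δ := by nlinarith
  have hqδ : (1 - r) * δ < δ := by nlinarith
  have hμc : μ1 < r * μ2 + (1 - r) * μ1 := by nlinarith
  have hcμ : r * μ2 + (1 - r) * μ1 < μ2 := by nlinarith
  have htp := mul_pos ht0 hp
  have htq := mul_pos ht0 hq
  have htp' := mul_pos (sub_pos.2 ht1) hp
  have htq' := mul_pos (sub_pos.2 ht1) hq
  unfold tubeLoss tubeTies tubeImbalance
  rw [hc']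
  generalize hc : r * μ2 + (1 - r) * μ1 = c at hμc hcμ ⊢
  have hac : μ1 + r * δ < c := by
    rw [← hc]; linarith [mul_pos hr0 (sub_pos.2 hδμ)]
  have hcb : c < μ2 - (1 - r) * δ := by
    rw [← hc]; linarith [mul_pos (sub_pos.2 hr1) (sub_pos.2 hδμ)]
  clear hc hc'
  have hy : y < μ1 - δ ∨ y = μ1 ∨ (μ1 + δ < y ∧ y < c) ∨ y = c ∨ (c < y ∧ y < μ2 - δ) ∨ y = μ2
      ∨ μ2 + δ < y := by
    clear hp hq hpδ hqδ htp htq htp' htq' ht0 ht1 hr0 hr1 hac hcb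
    grind
  clear h1 h2
  rcases hy with h | h | ⟨h, h'⟩ | h | ⟨h, h'⟩ | h | h <;>
    simp (disch := grind) only [if_pos, if_neg] <;>
    try linarith

/-- Unconditional weighted balance: if (μ1, μ2) with μ1 < μ2 globally minimizes the empirical tube-loss risk over {(a,b) : a ≤ b}, then |t·((1−r)·m1 + r·m4) − (1−t)·((1−r)·m2 + r·m3)| ≤ (1−r)·(k1 + k2) + r·k3. -/
theorem tubeLoss_minimizer_weighted_balance
    (t r : ℝ) (ht : t ∈ Set.Ioo (0 : ℝ) 1) (hr : r ∈ Set.Ioo (0 : ℝ) 1)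
    (m : ℕ) (y : Fin m → ℝ) (μ1 μ2 c : ℝ) (hμ : μ1 < μ2)
    (hc : c = r * μ2 + (1 - r) * μ1)
    (hmin : ∀ a b : ℝ, a ≤ b →
      (∑ i, tubeLoss t r (y i) μ1 μ2) ≤ ∑ i, tubeLoss t r (y i) a b)
    (m1 k1 m2 k2 m3 k3 m4 : ℝ)
    (hm1 : m1 = ((Finset.univ.filter (fun i => μ2 < y i)).card : ℝ))
    (hk1 : k1 = ((Finset.univ.filter (fun i => y i = μ2)).card : ℝ))
    (hm2 : m2 = ((Finset.univ.filter (fun i => c < y i ∧ y i < μ2)).card : ℝ))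
    (hk2 : k2 = ((Finset.univ.filter (fun i => y i = c)).card : ℝ))
    (hm3 : m3 = ((Finset.univ.filter (fun i => μ1 < y i ∧ y i < c)).card : ℝ))
    (hk3 : k3 = ((Finset.univ.filter (fun i => y i = μ1)).card : ℝ))
    (hm4 : m4 = ((Finset.univ.filter (fun i => y i < μ1)).card : ℝ)) :
    |t * ((1 - r) * m1 + r * m4) - (1 - t) * ((1 - r) * m2 + r * m3)| ≤ (1 - r) * (k1 + k2) + r * k3 := by
  subst hc
  have hwiden := sum_slope_nonneg_of_eventually_le _ _ _
    (fun i => tubeLoss_widen_eventually_le ht hr hμ (y i))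
    (by
      filter_upwards [self_mem_nhdsWithin] with δ hδ
      rw [Set.mem_Ioi] at hδ
      exact hmin _ _ (by linarith))
  have hnarrow := sum_slope_nonneg_of_eventually_le _ _ _
    (fun i => tubeLoss_narrow_eventually_le ht hr hμ (y i))
    (by
      filter_upwards [Ioo_mem_nhdsGT (sub_pos.2 hμ)] with δ hδ
      exact hmin _ _ (by linarith [hδ.2]))
  simp only [tubeTies, tubeImbalance, Finset.sum_add_distrib, Finset.sum_sub_distrib,
    ← Finset.mul_sum, Finset.sum_boole, ← hm1, ← hk1, ← hm2, ← hk2, ← hm3, ← hk3, ← hm4]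
    at hwiden hnarrow
  exact abs_le.2 ⟨by linarith, by linarith⟩
end
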